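/- Under the stated hypotheses, and assuming additionally that β(t) → +∞ as t → +∞, the objective values along the trajectory converge to the optimal value: for every z ∈ S, φ(x(t)) → φ(z) as t → +∞. -/

import Mathlib

open Filter MeasureTheory Set RealInnerProductSpace

/-- The gradient inequality for a differentiable convex function. -/
lemma ConvexOn.add_inner_gradient_le {H : Type*} [NormedAddCommGroup H] [InnerProductSpace ℝ H]
    [CompleteSpace H] {f : H → ℝ} (hf : ConvexOn ℝ univ f) (hd : Differentiable ℝ f) (a b : H) :
    f a + ⟪gradient f a, b - a⟫ ≤ f b := by
  have hline : ConvexOn ℝ univ (fun s : ℝ => f (AffineMap.lineMap a b s)) :=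
    hf.comp_affineMap (AffineMap.lineMap a b)
  have hderiv : HasDerivAt (fun s : ℝ => f (AffineMap.lineMap a b s)) ⟪gradient f a, b - a⟫ 0 := by
    have hg := (hd a).hasGradientAt.hasFDerivAt
    rw [show a = AffineMap.lineMap a b (0 : ℝ) by simp] at hg
    have := hg.comp_hasDerivAt (0 : ℝ) (AffineMap.hasDerivAt_lineMap (a := a) (b := b) (x := (0 : ℝ)))
    simpa only [Function.comp_def, AffineMap.lineMap_apply_zero, InnerProductSpace.toDual_apply_apply]
      using this
  have := hline.le_slope_of_hasDerivAt (mem_univ 0) (mem_univ 1) one_pos hderiv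
  simp only [slope_def_field, AffineMap.lineMap_apply_one, AffineMap.lineMap_apply_zero, sub_zero,
    div_one] at this
  linarith

/-- First-order optimality condition for minimising over a convex set. -/
lemma IsMinOn.inner_gradient_nonneg {H : Type*} [NormedAddCommGroup H] [InnerProductSpace ℝ H]
    [CompleteSpace H] {f : H → ℝ} {s : Set H} {z y : H} (h : IsMinOn f s z)
    (hd : DifferentiableAt ℝ f z) (hs : Convex ℝ s) (hz : z ∈ s) (hy : y ∈ s) :
    0 ≤ ⟪gradient f z, y - z⟫ := by
  simpa using h.localize.hasFDerivWithinAt_nonneg hd.hasGradientAt.hasFDerivAt.hasFDerivWithinAt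
    (sub_mem_posTangentConeAt_of_segment_subset (hs.segment_subset hz hy))

lemma ContinuousOn.intervalIntegrable_of_Ici {f : ℝ → ℝ} {c a b : ℝ} (hf : ContinuousOn f (Ici c))
    (ha : c ≤ a) (hb : c ≤ b) : IntervalIntegrable f volume a b :=
  (hf.mono fun _ hx => (le_inf ha hb).trans hx.1).intervalIntegrable

lemma integral_eq_sub_of_hasDerivWithinAt_Ici {F D : ℝ → ℝ} {a T : ℝ}
    (hF : ∀ t ∈ Ici a, HasDerivWithinAt F (D t) (Ici a) t) (hD : ContinuousOn D (Ici a))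
    (hT : a ≤ T) : ∫ t in a..T, D t = F T - F a :=
  intervalIntegral.integral_eq_sub_of_hasDerivAt_of_le hT
    (fun t ht => (hF t ht.1).continuousWithinAt.mono Icc_subset_Ici_self)
    (fun t ht => (hF t ht.1.le).hasDerivAt (Ici_mem_nhds ht.1))
    (hD.intervalIntegrable_of_Ici le_rfl hT)

lemma sub_le_integral_of_hasDerivWithinAt_Ici_le {F D G : ℝ → ℝ} {a T : ℝ}
    (hF : ∀ t ∈ Ici a, HasDerivWithinAt F (D t) (Ici a) t) (hD : ContinuousOn D (Ici a))
    (hG : ContinuousOn G (Ici a)) (hDG : ∀ t ∈ Ici a, D t ≤ G t) (hT : a ≤ T) :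
    F T - F a ≤ ∫ t in a..T, G t := by
  rw [← integral_eq_sub_of_hasDerivWithinAt_Ici hF hD hT]
  exact intervalIntegral.integral_mono_on hT (hD.intervalIntegrable_of_Ici le_rfl hT)
    (hG.intervalIntegrable_of_Ici le_rfl hT) fun t ht => hDG t ht.1

/-- A linear differential inequality `h' + γ h ≤ K` with `γ > 0` bounds `h` from above. -/
lemma le_max_of_deriv_add_mul_le {h h₁ : ℝ → ℝ} {γ K : ℝ} (hγ : 0 < γ)
    (hh : ∀ t ∈ Ici (0 : ℝ), HasDerivWithinAt h (h₁ t) (Ici 0) t)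
    (hh₁ : ContinuousOn h₁ (Ici 0)) (hK : ∀ t ∈ Ici (0 : ℝ), h₁ t + γ * h t ≤ K)
    {t : ℝ} (ht : 0 ≤ t) : h t ≤ max (h 0) (K / γ) := by
  set R := max (h 0) (K / γ)
  have hKR : K ≤ γ * R := by
    rw [mul_comm, ← div_le_iff₀ hγ]
    exact le_max_right _ _
  have hhc : ContinuousOn h (Ici 0) := fun s hs => (hh s hs).continuousWithinAt
  have hder : ∀ s ∈ Ici (0 : ℝ), HasDerivWithinAt (fun s => Real.exp (γ * s) * (h s - R))
      (Real.exp (γ * s) * (h₁ s + γ * h s - γ * R)) (Ici 0) s := fun s hs => by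
    have h₂ : HasDerivWithinAt (fun s => Real.exp (γ * s)) (Real.exp (γ * s) * γ) (Ici 0) s := by
      simpa using (((hasDerivAt_id s).const_mul γ).exp).hasDerivWithinAt
    exact (h₂.mul ((hh s hs).sub_const R)).congr_deriv (by ring)
  have hle := sub_le_integral_of_hasDerivWithinAt_Ici_le (G := fun _ => 0) hder (by fun_prop)
    continuousOn_const (fun s hs => mul_nonpos_of_nonneg_of_nonpos (Real.exp_pos _).le
      (by linarith [hK s hs])) ht
  have h0 : h 0 ≤ R := le_max_left _ _
  simp only [mul_zero, Real.exp_zero, one_mul, intervalIntegral.integral_zero] at hle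
  by_contra! hlt
  have := mul_pos (Real.exp_pos (γ * t)) (sub_pos.2 hlt)
  linarith

/-- A function whose derivative is dominated by a function with bounded integrals converges. -/
lemma exists_tendsto_of_abs_deriv_le {F D G : ℝ → ℝ} {C : ℝ}
    (hF : ∀ t ∈ Ici (0 : ℝ), HasDerivWithinAt F (D t) (Ici 0) t) (hD : ContinuousOn D (Ici 0))
    (hG : ContinuousOn G (Ici 0)) (hDG : ∀ t ∈ Ici (0 : ℝ), |D t| ≤ G t)
    (hC : ∀ T, 0 ≤ T → ∫ t in (0 : ℝ)..T, G t ≤ C) : ∃ l, Tendsto F atTop (nhds l) := by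
  have hint : IntegrableOn D (Ioi 0) := by
    refine integrableOn_Ioi_of_intervalIntegral_norm_bounded C 0 (b := fun T : ℝ => T) (l := atTop)
      (fun T => ((hD.mono Icc_subset_Ici_self).integrableOn_Icc).mono_set Ioc_subset_Icc_self)
      tendsto_id ?_
    filter_upwards [eventually_ge_atTop 0] with T hT
    refine le_trans (intervalIntegral.integral_mono_on hT ?_
      (hG.intervalIntegrable_of_Ici le_rfl hT) fun t ht => hDG t ht.1) (hC T hT)
    exact hD.norm.intervalIntegrable_of_Ici le_rfl hT
  refine ⟨(∫ t in Ioi 0, D t) + F 0, ?_⟩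
  refine ((intervalIntegral_tendsto_integral_Ioi 0 hint tendsto_id).add_const (F 0)).congr' ?_
  filter_upwards [eventually_ge_atTop 0] with T hT
  rw [id, integral_eq_sub_of_hasDerivWithinAt_Ici hF hD hT]
  ring

lemma nonpos_of_tendsto_of_integral_le {F : ℝ → ℝ} {l C : ℝ} (hF : ContinuousOn F (Ici 0))
    (hl : Tendsto F atTop (nhds l)) (hC : ∀ T, 0 ≤ T → ∫ t in (0 : ℝ)..T, F t ≤ C) : l ≤ 0 := by
  by_contra! hpos
  obtain ⟨a, ha⟩ := eventually_atTop.1 (hl.eventually_const_le (half_lt_self hpos))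
  set s := max a 0
  have hs : 0 ≤ s := le_max_right _ _
  have hlow : ∀ T, s ≤ T → (∫ t in (0 : ℝ)..s, F t) + (T - s) * (l / 2) ≤ C := fun T hT => by
    have hF₂ := hF.intervalIntegrable_of_Ici hs (hs.trans hT)
    have h₁ := hC T (hs.trans hT)
    rw [← intervalIntegral.integral_add_adjacent_intervals
      (hF.intervalIntegrable_of_Ici le_rfl hs) hF₂] at h₁
    have h₂ := intervalIntegral.integral_mono_on hT intervalIntegrable_const hF₂
      fun t ht => ha t ((le_max_left _ _).trans ht.1)
    rw [intervalIntegral.integral_const, smul_eq_mul] at h₂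
    linarith
  have hT : Tendsto (fun T => (∫ t in (0 : ℝ)..s, F t) + (T - s) * (l / 2)) atTop atTop :=
    tendsto_atTop_add_const_left _ _ <|
      (tendsto_atTop_add_const_right _ _ tendsto_id).atTop_mul_const (half_pos hpos)
  obtain ⟨T, hT₁, hT₂⟩ := ((hT.eventually_gt_atTop C).and (eventually_ge_atTop s)).exists
  linarith [hlow T hT₂]

/-- Scalar energy estimate: `E = u / 2 + e + b` is the energy, `h` the anchor function. -/
lemma energy_estimate {h h₁ h₂ E E₁ e u b w : ℝ → ℝ} {γ k M C : ℝ}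
    (hγ : 0 < γ) (hk : 0 ≤ k) (hkγ : k < γ)
    (hh : ∀ t ∈ Ici (0 : ℝ), HasDerivWithinAt h (h₁ t) (Ici 0) t)
    (hh₁ : ∀ t ∈ Ici (0 : ℝ), HasDerivWithinAt h₁ (h₂ t) (Ici 0) t)
    (hE : ∀ t ∈ Ici (0 : ℝ), HasDerivWithinAt E (E₁ t) (Ici 0) t)
    (hh₂c : ContinuousOn h₂ (Ici 0)) (hE₁c : ContinuousOn E₁ (Ici 0))
    (huc : ContinuousOn u (Ici 0)) (hbc : ContinuousOn b (Ici 0))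
    (hwc : ContinuousOn w (Ici 0))
    (hEdef : ∀ t, E t = u t / 2 + e t + b t)
    (hh0 : ∀ t ∈ Ici (0 : ℝ), 0 ≤ h t) (hu0 : ∀ t ∈ Ici (0 : ℝ), 0 ≤ u t)
    (hb0 : ∀ t ∈ Ici (0 : ℝ), 0 ≤ b t) (he : ∀ t ∈ Ici (0 : ℝ), -M ≤ e t)
    (hh₂ : ∀ t ∈ Ici (0 : ℝ), h₂ t + γ * h₁ t + e t + b t ≤ u t)
    (hE₁ : ∀ t ∈ Ici (0 : ℝ), |E₁ t + γ * u t| ≤ k * b t)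
    (hh₁u : ∀ t ∈ Ici (0 : ℝ), h₁ t ^ 2 ≤ 2 * h t * u t)
    (hw : ∀ t ∈ Ici (0 : ℝ), -e t ≤ w t + (1 - k / γ) / 2 * b t)
    (hwC : ∀ T, 0 ≤ T → ∫ t in (0 : ℝ)..T, w t ≤ C) :
    (∃ B, ∀ t ∈ Ici (0 : ℝ), b t ≤ B) ∧ ∃ l ≤ 0, Tendsto E atTop (nhds l) := by
  have hc : 0 < 1 - k / γ := by
    rw [sub_pos, div_lt_one hγ]
    exact hkγ
  set c := 1 - k / γ with hcdef
  have hhc : ContinuousOn h (Ici 0) := fun t ht => (hh t ht).continuousWithinAt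
  have hh₁c : ContinuousOn h₁ (Ici 0) := fun t ht => (hh₁ t ht).continuousWithinAt
  have hEc : ContinuousOn E (Ici 0) := fun t ht => (hE t ht).continuousWithinAt
  have hint {f : ℝ → ℝ} (hf : ContinuousOn f (Ici 0)) {T : ℝ} (hT : 0 ≤ T) :
      IntervalIntegrable f volume 0 T := hf.intervalIntegrable_of_Ici le_rfl hT
  have hint0 {f : ℝ → ℝ} (hf : ∀ t ∈ Ici (0 : ℝ), 0 ≤ f t) {T : ℝ} (hT : 0 ≤ T) :
      0 ≤ ∫ t in (0 : ℝ)..T, f t :=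
    intervalIntegral.integral_nonneg hT fun t ht => hf t ht.1
  have hh₁der : ∀ t ∈ Ici (0 : ℝ),
      HasDerivWithinAt (fun t => h₁ t + γ * h t) (h₂ t + γ * h₁ t) (Ici 0) t :=
    fun t ht => (hh₁ t ht).add ((hh t ht).const_mul γ)
  -- the Lyapunov function `h₁ + γ h + E / γ` is bounded above
  have hlyap : ∀ T, 0 ≤ T → h₁ T + γ * h T + E T / γ + c / 2 * ∫ t in (0 : ℝ)..T, b t ≤
      h₁ 0 + γ * h 0 + E 0 / γ + C := fun T hT => by
    have hder : ∀ t ∈ Ici (0 : ℝ), HasDerivWithinAt (fun t => h₁ t + γ * h t + E t / γ)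
        (h₂ t + γ * h₁ t + E₁ t / γ) (Ici 0) t :=
      fun t ht => (hh₁der t ht).add ((hE t ht).div_const γ)
    have hle := sub_le_integral_of_hasDerivWithinAt_Ici_le (G := fun t => w t - c / 2 * b t) hder
      (by fun_prop) (by fun_prop) (fun t ht => by
        have h₃ : E₁ t / γ ≤ -u t + k / γ * b t := by
          rw [div_le_iff₀ hγ]
          have : (-u t + k / γ * b t) * γ = -γ * u t + k * b t := by field_simp
          linarith [(abs_le.1 (hE₁ t ht)).2]
        have h₄ := hh₂ t ht
        have h₅ := hw t ht
        have h₆ : k / γ * b t = b t - c * b t := by rw [hcdef]; ring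
        linarith) hT
    rw [intervalIntegral.integral_sub (hint hwc hT) ((hint hbc hT).const_mul _),
      intervalIntegral.integral_const_mul] at hle
    linarith [hwC T hT]
  set K := h₁ 0 + γ * h 0 + E 0 / γ + C
  have hElow : ∀ t ∈ Ici (0 : ℝ), u t / 2 + b t - M ≤ E t := fun t ht => by
    linarith [hEdef t, he t ht]
  have hElow' : ∀ t ∈ Ici (0 : ℝ), u t / (2 * γ) - M / γ ≤ E t / γ := fun t ht => by
    rw [show u t / (2 * γ) - M / γ = (u t / 2 - M) / γ by field_simp]
    gcongr
    linarith [hElow t ht, hb0 t ht]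
  have hhu : ∀ t ∈ Ici (0 : ℝ), h₁ t + γ * h t + u t / (2 * γ) ≤ K + M / γ := fun t ht => by
    have := mul_nonneg (half_pos hc).le (hint0 hb0 ht)
    linarith [hlyap t ht, hElow' t ht]
  obtain ⟨R, hR⟩ : ∃ R, ∀ t ∈ Ici (0 : ℝ), h t ≤ R := by
    refine ⟨_, fun t ht => le_max_of_deriv_add_mul_le (K := K + M / γ) hγ hh hh₁c
      (fun s hs => ?_) ht⟩
    have : 0 ≤ u s / (2 * γ) := div_nonneg (hu0 s hs) (by positivity)
    linarith [hhu s hs]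
  have hh₁abs : ∀ t ∈ Ici (0 : ℝ), |h₁ t| ≤ 2 * γ * h t + u t / (4 * γ) := fun t ht => by
    have h₃ := hh0 t ht
    have h₄ := hu0 t ht
    refine abs_le_of_sq_le_sq ((hh₁u t ht).trans ?_) (by positivity)
    have h₅ : (2 * γ * h t + u t / (4 * γ)) ^ 2 =
        (2 * γ * h t - u t / (4 * γ)) ^ 2 + 2 * h t * u t := by
      field_simp
      ring
    nlinarith [sq_nonneg (2 * γ * h t - u t / (4 * γ))]
  obtain ⟨V, hV⟩ : ∃ V, ∀ t ∈ Ici (0 : ℝ), u t / (4 * γ) ≤ V := by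
    refine ⟨K + M / γ + γ * R, fun t ht => ?_⟩
    have h₃ : u t / (2 * γ) = u t / (4 * γ) + u t / (4 * γ) := by field_simp; ring
    have h₄ := mul_le_mul_of_nonneg_left (hR t ht) hγ.le
    linarith [hhu t ht, (abs_le.1 (hh₁abs t ht)).1]
  have hh₁low : ∀ t ∈ Ici (0 : ℝ), -(2 * γ * R + V) ≤ h₁ t := fun t ht => by
    have h₄ := mul_le_mul_of_nonneg_left (hR t ht) hγ.le
    linarith [(abs_le.1 (hh₁abs t ht)).1, hV t ht]
  have hEM : ∀ t ∈ Ici (0 : ℝ), -M ≤ E t := fun t ht => by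
    linarith [hElow t ht, hb0 t ht, hu0 t ht]
  obtain ⟨B, hB⟩ : ∃ B, ∀ T, 0 ≤ T → ∫ t in (0 : ℝ)..T, b t ≤ B := by
    refine ⟨(K + M / γ + (2 * γ * R + V)) / (c / 2), fun T hT => ?_⟩
    rw [le_div_iff₀ (half_pos hc), mul_comm]
    have h₃ := mul_nonneg hγ.le (hh0 T hT)
    have h₄ : 0 ≤ u T / (2 * γ) := div_nonneg (hu0 T hT) (by positivity)
    linarith [hlyap T hT, hElow' T hT, hh₁low T hT]
  have hEU : ∀ T, 0 ≤ T → E T + γ * ∫ t in (0 : ℝ)..T, u t ≤ E 0 + k * B := fun T hT => by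
    have hle := sub_le_integral_of_hasDerivWithinAt_Ici_le (G := fun t => k * b t - γ * u t) hE
      hE₁c (by fun_prop) (fun t ht => by linarith [(abs_le.1 (hE₁ t ht)).2]) hT
    rw [intervalIntegral.integral_sub ((hint hbc hT).const_mul _) ((hint huc hT).const_mul _),
      intervalIntegral.integral_const_mul, intervalIntegral.integral_const_mul] at hle
    linarith [mul_le_mul_of_nonneg_left (hB T hT) hk]
  have hγU : ∀ T, 0 ≤ T → γ * ∫ t in (0 : ℝ)..T, u t ≤ E 0 + k * B + M := fun T hT => by
    linarith [hEU T hT, hEM T hT]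
  refine ⟨⟨E 0 + k * B + M, fun t ht => ?_⟩, ?_⟩
  · linarith [hElow t ht, hu0 t ht, hEU t ht, mul_nonneg hγ.le (hint0 hu0 ht)]
  · obtain ⟨l, hl⟩ := exists_tendsto_of_abs_deriv_le (G := fun t => γ * u t + k * b t)
      (C := E 0 + k * B + M + k * B) hE hE₁c (by fun_prop)
      (fun t ht => by
        have h₃ := abs_le.1 (hE₁ t ht)
        have h₄ := mul_nonneg hγ.le (hu0 t ht)
        exact abs_le.2 ⟨by linarith, by linarith⟩)
      (fun T hT => by
        rw [intervalIntegral.integral_add ((hint huc hT).const_mul _) ((hint hbc hT).const_mul _),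
          intervalIntegral.integral_const_mul, intervalIntegral.integral_const_mul]
        linarith [hγU T hT, mul_le_mul_of_nonneg_left (hB T hT) hk])
    refine ⟨l, nonpos_of_tendsto_of_integral_le (C := 3 / 2 * ((E 0 + k * B + M) / γ) +
      (h₁ 0 + γ * h 0) + (2 * γ * R + V)) hEc hl fun T hT => ?_, hl⟩
    have hle := sub_le_integral_of_hasDerivWithinAt_Ici_le (G := fun t => 3 / 2 * u t - E t)
      hh₁der (by fun_prop) (by fun_prop)
      (fun t ht => by linarith [hh₂ t ht, hEdef t]) hT
    rw [intervalIntegral.integral_sub ((hint huc hT).const_mul _) (hint hEc hT),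
      intervalIntegral.integral_const_mul] at hle
    have h₃ : ∫ t in (0 : ℝ)..T, u t ≤ (E 0 + k * B + M) / γ := by
      rw [le_div_iff₀ hγ, mul_comm]
      exact hγU T hT
    linarith [hh₁low T hT, mul_nonneg hγ.le (hh0 T hT)]

/-- Consequences of the integrability of the conjugate gap: an integral bound along any curve, and
a uniform pointwise decay. -/
lemma conjugate_gap_bounds {H : Type*} [NormedAddCommGroup H] [InnerProductSpace ℝ H]
    {ψ : H → ℝ} {β : ℝ → ℝ} {z q : H} (hψ : ∀ y, 0 ≤ ψ y) (hβpos : ∀ t ∈ Ici (0 : ℝ), 0 < β t)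
    (hβmono : MonotoneOn β (Ici 0))
    (hH : ∫⁻ t in Ici (0 : ℝ), ⨆ w : H,
      ENNReal.ofReal (β t * ((⟪(β t)⁻¹ • q, w⟫ - ψ w) - ⟪(β t)⁻¹ • q, z⟫)) ≠ ⊤) :
    ∃ C, (∀ x : ℝ → H, ContinuousOn (fun t => ⟪q, x t - z⟫ - β t * ψ (x t)) (Ici 0) →
      ∀ T, 0 ≤ T → ∫ t in (0 : ℝ)..T, max (⟪q, x t - z⟫ - β t * ψ (x t)) 0 ≤ C) ∧
      ∀ T, 0 ≤ T → ∀ w, (⟪q, w - z⟫ - β T * ψ w) * T ≤ C := by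
  set G : ℝ → ENNReal := fun t => ⨆ w : H,
    ENNReal.ofReal (β t * ((⟪(β t)⁻¹ • q, w⟫ - ψ w) - ⟪(β t)⁻¹ • q, z⟫))
  have hle : ∀ t ∈ Ici (0 : ℝ), ∀ w, ENNReal.ofReal (⟪q, w - z⟫ - β t * ψ w) ≤ G t := by
    intro t ht w
    refine le_trans (le_of_eq ?_) (le_iSup _ w)
    have := (hβpos t ht).ne'
    congr 1
    rw [real_inner_smul_left, real_inner_smul_left, inner_sub_right]
    field_simp
    ring
  have hset : ∀ T, 0 ≤ T → ∀ f : ℝ → ℝ, (∀ t ∈ Icc 0 T, ENNReal.ofReal (f t) ≤ G t) →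
      ∫⁻ t in Icc 0 T, ENNReal.ofReal (f t) ≤ ∫⁻ t in Ici 0, G t := fun T hT f hf =>
    (setLIntegral_mono' measurableSet_Icc hf).trans (lintegral_mono_set Icc_subset_Ici_self)
  refine ⟨(∫⁻ t in Ici 0, G t).toReal, fun x hx T hT => ?_, fun T hT w => ?_⟩
  · have hc : ContinuousOn (fun t => max (⟪q, x t - z⟫ - β t * ψ (x t)) 0) (Icc 0 T) :=
      (hx.sup continuousOn_const).mono Icc_subset_Ici_self
    rw [intervalIntegral.integral_of_le hT, ← integral_Icc_eq_integral_Ioc,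
      integral_eq_lintegral_of_nonneg_ae (f := fun t => max (⟪q, x t - z⟫ - β t * ψ (x t)) 0)
        (Eventually.of_forall fun t => le_max_right _ _)
        hc.integrableOn_Icc.aestronglyMeasurable]
    refine ENNReal.toReal_mono hH (hset T hT _ fun t ht => ?_)
    rw [ENNReal.ofReal_max, ENNReal.ofReal_zero, max_eq_left zero_le]
    exact hle t ht.1 _
  · have h₁ := hset T hT (fun _ => ⟪q, w - z⟫ - β T * ψ w) fun t ht =>
      (ENNReal.ofReal_le_ofReal (by
        have := mul_le_mul_of_nonneg_right (hβmono ht.1 (mem_Ici.2 hT) ht.2) (hψ w)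
        linarith)).trans (hle t ht.1 w)
    rw [setLIntegral_const, Real.volume_Icc, sub_zero, ← ENNReal.ofReal_mul' hT] at h₁
    exact (ENNReal.ofReal_le_iff_le_toReal hH).1 h₁

theorem stmt9 {H : Type*} [NormedAddCommGroup H] [InnerProductSpace ℝ H] [CompleteSpace H]
    (φ ψ : H → ℝ) (γ k : ℝ) (β β' : ℝ → ℝ) (x x' x'' : ℝ → H)
    -- ψ is convex, Fréchet differentiable with Lipschitz continuous gradient,
    -- nonnegative, and argmin ψ = ψ⁻¹(0) is nonempty
    (hψconv : ConvexOn ℝ univ ψ)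
    (hψdiff : Differentiable ℝ ψ)
    (hψlip : ∃ L : NNReal, LipschitzWith L (gradient ψ))
    (hψnonneg : ∀ y, 0 ≤ ψ y)
    (hψmin : ∃ y, ψ y = 0)
    -- φ is convex, Fréchet differentiable with Lipschitz continuous gradient,
    -- bounded from below, and S = {z ∈ argmin ψ : φ z ≤ φ y ∀ y ∈ argmin ψ} is nonempty
    (hφconv : ConvexOn ℝ univ φ)
    (hφdiff : Differentiable ℝ φ)
    (hφlip : ∃ L : NNReal, LipschitzWith L (gradient φ))
    (hφbdd : BddBelow (range φ))
    (hS : ∃ z : H, ψ z = 0 ∧ ∀ y, ψ y = 0 → φ z ≤ φ y)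
    -- γ > 0, 0 ≤ k < γ, and β : [0,∞) → (0,∞) is a C¹ function (with derivative β')
    -- satisfying the growth condition 0 ≤ β' ≤ k β
    (hγ : 0 < γ) (hk : 0 ≤ k) (hkγ : k < γ)
    (hβpos : ∀ t ∈ Ici (0 : ℝ), 0 < β t)
    (hβderiv : ∀ t ∈ Ici (0 : ℝ), HasDerivWithinAt β (β' t) (Ici 0) t)
    (hβ'cont : ContinuousOn β' (Ici 0))
    (hβgrowth : ∀ t ∈ Ici (0 : ℝ), 0 ≤ β' t ∧ β' t ≤ k * β t)
    -- condition (H): for every p in the range of the normal cone to argmin ψ (i.e.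
    -- p ∈ N(z) for some z ∈ argmin ψ = ψ⁻¹(0)), the integral
    -- ∫_0^∞ β(t) [ψ*(p/β(t)) - σ(p/β(t))] dt is finite; here σ(p/β(t)) = ⟪p/β(t), z⟫
    -- since p ∈ N(z), and β(t)[ψ*(q) - ⟪q, z⟫] = ⨆ w, β(t)((⟪q, w⟫ - ψ w) - ⟪q, z⟫) ≥ 0.
    (hH : ∀ z p : H, ψ z = 0 → (∀ y, ψ y = 0 → ⟪p, y - z⟫ ≤ 0) →
      ∫⁻ t in Ici (0 : ℝ), ⨆ w : H,
        ENNReal.ofReal (β t * ((⟪(β t)⁻¹ • p, w⟫ - ψ w) - ⟪(β t)⁻¹ • p, z⟫)) ≠ ⊤)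
    -- x : [0,∞) → H is twice continuously differentiable (first derivative x',
    -- second derivative x'') and satisfies ẍ + γ ẋ + ∇φ(x) + β ∇ψ(x) = 0 on [0,∞)
    (hx' : ∀ t ∈ Ici (0 : ℝ), HasDerivWithinAt x (x' t) (Ici 0) t)
    (hx'' : ∀ t ∈ Ici (0 : ℝ), HasDerivWithinAt x' (x'' t) (Ici 0) t)
    (hx''cont : ContinuousOn x'' (Ici 0))
    (hode : ∀ t ∈ Ici (0 : ℝ),
      x'' t + γ • x' t + gradient φ (x t) + β t • gradient ψ (x t) = 0)
    -- β(t) → +∞ as t → +∞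
    (hβinf : Tendsto β atTop atTop) :
    ∀ z : H, (ψ z = 0 ∧ ∀ y, ψ y = 0 → φ z ≤ φ y) →
      Tendsto (fun t => φ (x t)) atTop (nhds (φ z)) := by
  rintro z ⟨hz, hzmin⟩
  obtain ⟨Lφ, hLφ⟩ := hφlip
  obtain ⟨m, hm⟩ := hφbdd
  have hβmono : MonotoneOn β (Ici 0) := by
    refine monotoneOn_of_hasDerivWithinAt_nonneg (f' := β') (convex_Ici 0)
      (fun t ht => (hβderiv t ht).continuousWithinAt) (fun t ht => ?_) fun t ht => ?_
    · exact (hβderiv t (interior_subset ht)).mono interior_subset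
    · exact (hβgrowth t (interior_subset ht)).1
  set p : H := -gradient φ z with hpdef
  have hp : ∀ y, ψ y = 0 → ⟪p, y - z⟫ ≤ 0 := fun y hy => by
    have hconv : Convex ℝ {y | ψ y = 0} := by
      have := hψconv.convex_le 0
      simpa only [mem_univ, true_and, (hψnonneg _).ge_iff_eq'] using this
    have := IsMinOn.inner_gradient_nonneg (s := {y | ψ y = 0}) (z := z) (y := y)
      (fun y hy => hzmin y hy) (hφdiff z) hconv hz hy
    rw [hpdef, inner_neg_left]
    linarith
  have hφp : ∀ y, φ z - φ y ≤ ⟪p, y - z⟫ := fun y => by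
    have := hφconv.add_inner_gradient_le hφdiff z y
    rw [hpdef, inner_neg_left]
    linarith
  have hgap : ∀ s : ℝ, 0 ≤ s → _ := fun s hs =>
    conjugate_gap_bounds hψnonneg hβpos hβmono (hH z (s • p) hz fun y hy => by
      rw [real_inner_smul_left]
      exact mul_nonpos_of_nonneg_of_nonpos hs (hp y hy))
  have hxc : ContinuousOn x (Ici 0) := fun t ht => (hx' t ht).continuousWithinAt
  have hx'c : ContinuousOn x' (Ici 0) := fun t ht => (hx'' t ht).continuousWithinAt
  have hβc : ContinuousOn β (Ici 0) := fun t ht => (hβderiv t ht).continuousWithinAt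
  have hψx : ContinuousOn (fun t => ψ (x t)) (Ici 0) := hψdiff.continuous.comp_continuousOn hxc
  have hβψ : ContinuousOn (fun t => β t * ψ (x t)) (Ici 0) := hβc.mul hψx
  have hc : 0 < 1 - k / γ := by
    rw [sub_pos, div_lt_one hγ]
    exact hkγ
  obtain ⟨C, hC, -⟩ := hgap (2 / (1 - k / γ)) (by positivity)
  have hgapc : ContinuousOn
      (fun t => ⟪(2 / (1 - k / γ)) • p, x t - z⟫ - β t * ψ (x t)) (Ici 0) :=
    (continuousOn_const.inner (hxc.sub continuousOn_const)).sub hβψ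
  obtain ⟨⟨B, hB⟩, l, hl0, hl⟩ := energy_estimate
    (h := fun t => ‖x t - z‖ ^ 2 / 2) (h₁ := fun t => ⟪x t - z, x' t⟫)
    (h₂ := fun t => ⟪x t - z, x'' t⟫ + ‖x' t‖ ^ 2)
    (E := fun t => ‖x' t‖ ^ 2 / 2 + (φ (x t) - φ z) + β t * ψ (x t))
    (E₁ := fun t => -γ * ‖x' t‖ ^ 2 + β' t * ψ (x t))
    (e := fun t => φ (x t) - φ z) (u := fun t => ‖x' t‖ ^ 2) (b := fun t => β t * ψ (x t))
    (w := fun t => (1 - k / γ) / 2 *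
      max (⟪(2 / (1 - k / γ)) • p, x t - z⟫ - β t * ψ (x t)) 0)
    (M := φ z - m) (C := (1 - k / γ) / 2 * C) hγ hk hkγ
    (fun t ht => by
      exact (((hx' t ht).sub_const z).norm_sq.div_const 2).congr_deriv (by ring))
    (fun t ht => by
      refine (((hx' t ht).sub_const z).inner ℝ (hx'' t ht)).congr_deriv ?_
      rw [real_inner_self_eq_norm_sq])
    (fun t ht => by
      have hφ' := (hφdiff (x t)).hasGradientAt.hasFDerivAt.comp_hasDerivWithinAt t (hx' t ht)
      have hψ' := (hψdiff (x t)).hasGradientAt.hasFDerivAt.comp_hasDerivWithinAt t (hx' t ht)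
      refine ((((hx'' t ht).norm_sq.div_const 2).add (hφ'.sub_const (φ z))).add
        ((hβderiv t ht).mul hψ')).congr_deriv ?_
      have hode' := congrArg (fun v => ⟪v, x' t⟫) (hode t ht)
      simp only [inner_add_left, real_inner_smul_left, inner_zero_left,
        real_inner_self_eq_norm_sq] at hode'
      simp only [InnerProductSpace.toDual_apply_apply, Function.comp_apply]
      rw [real_inner_comm]
      linarith)
    (by fun_prop) (((hx'c.norm.pow 2).const_mul (-γ)).add (hβ'cont.mul hψx)) (by fun_prop) hβψ
    (continuousOn_const.mul (hgapc.sup continuousOn_const))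
    (fun t => rfl) (fun t _ => by positivity) (fun t _ => by positivity)
    (fun t ht => mul_nonneg (hβpos t ht).le (hψnonneg _))
    (fun t _ => by linarith [hm (mem_range_self (x t))])
    (fun t ht => by
      have hode' := congrArg (fun v => ⟪x t - z, v⟫) (hode t ht)
      simp only [inner_add_right, real_inner_smul_right, inner_zero_right] at hode'
      have h₁ := hφconv.add_inner_gradient_le hφdiff (x t) z
      have h₂ := hψconv.add_inner_gradient_le hψdiff (x t) z
      rw [← neg_sub (x t) z, inner_neg_right, real_inner_comm] at h₁ h₂
      rw [hz] at h₂
      have h₃ : β t * ψ (x t) ≤ β t * ⟪x t - z, gradient ψ (x t)⟫ :=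
        mul_le_mul_of_nonneg_left (by linarith) (hβpos t ht).le
      linarith)
    (fun t ht => by
      rw [show -γ * ‖x' t‖ ^ 2 + β' t * ψ (x t) + γ * ‖x' t‖ ^ 2 = β' t * ψ (x t) by ring,
        abs_of_nonneg (mul_nonneg (hβgrowth t ht).1 (hψnonneg _)), ← mul_assoc]
      exact mul_le_mul_of_nonneg_right (hβgrowth t ht).2 (hψnonneg _))
    (fun t _ => by
      rw [← sq_abs]
      have := pow_le_pow_left₀ (abs_nonneg _) (abs_real_inner_le_norm (x t - z) (x' t)) 2
      linarith [mul_pow ‖x t - z‖ ‖x' t‖ 2])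
    (fun t _ => by
      have h₁ := mul_le_mul_of_nonneg_left
        (le_max_left (⟪(2 / (1 - k / γ)) • p, x t - z⟫ - β t * ψ (x t)) 0) (half_pos hc).le
      have h₂ : (1 - k / γ) / 2 * (⟪(2 / (1 - k / γ)) • p, x t - z⟫ - β t * ψ (x t)) =
          ⟪p, x t - z⟫ - (1 - k / γ) / 2 * (β t * ψ (x t)) := by
        rw [real_inner_smul_left, mul_sub, ← mul_assoc, ← inv_div 2, inv_mul_cancel₀ (by positivity),
          one_mul]
      linarith [hφp (x t)])
    (fun T hT => by
      rw [intervalIntegral.integral_const_mul]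
      exact mul_le_mul_of_nonneg_left (hC x hgapc T hT) (half_pos hc).le)
  refine tendsto_order.2 ⟨fun a ha => ?_, fun a ha => ?_⟩
  · obtain ⟨s, hs, hBs⟩ : ∃ s : ℝ, 0 < s ∧ B + 1 < s * (φ z - a) := by
      have hpos : 0 < φ z - a := sub_pos.2 ha
      refine ⟨(|B| + 2) / (φ z - a), by positivity, ?_⟩
      rw [div_mul_cancel₀ _ hpos.ne']
      linarith [le_abs_self B]
    obtain ⟨C', -, hC'⟩ := hgap s hs.le
    filter_upwards [eventually_gt_atTop 0, eventually_ge_atTop C'] with t ht htC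
    have h₁ : ⟪s • p, x t - z⟫ - β t * ψ (x t) ≤ 1 :=
      le_of_mul_le_mul_right ((hC' t ht.le (x t)).trans (by linarith)) ht
    rw [real_inner_smul_left] at h₁
    have h₂ := mul_le_mul_of_nonneg_left (hφp (x t)) hs.le
    have h₃ : s * (φ z - φ (x t)) < s * (φ z - a) := by linarith [hB t ht.le]
    linarith [lt_of_mul_lt_mul_left h₃ hs.le]
  · filter_upwards [hl.eventually_lt_const (u := a - φ z) (by linarith),
      eventually_ge_atTop 0] with t ht ht0
    have h₁ := mul_nonneg (hβpos t ht0).le (hψnonneg (x t))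
    have h₂ := sq_nonneg ‖x' t‖
    linarith
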